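/- There exists a universal constant c > 0 with the following property. Let γ > 0, let f be a smooth mean-zero 2π-periodic function, and let u and ũ be two smooth solutions of the damped–driven KdV equation with damping γ and forcing f. Then for every t ≥ 0, ‖u(t,·) − ũ(t,·)‖_{L²} ≤ ‖u(0,·) − ũ(0,·)‖_{L²} · exp( −γ t + c ∫₀^t ‖∂_x²(u + ũ)(s,·)‖_{L²}^{3/4} · ‖(u + ũ)(s,·)‖_{L²}^{1/4} ds ). -/

import Mathlib

open MeasureTheory Real Filter

noncomputable section

/-- A smooth, mean-zero, `2π`-periodic function `v : ℝ → ℝ`. -/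
def SmoothMeanZeroPeriodic (v : ℝ → ℝ) : Prop :=
  ContDiff ℝ (⊤ : ℕ∞) v ∧ (∀ x : ℝ, v (x + 2 * Real.pi) = v x) ∧
    (∫ x in (0:ℝ)..(2 * Real.pi), v x) = 0

/-- The `L²` norm over one period: `(∫₀^{2π} |v|²)^{1/2}`. -/
def L2norm (v : ℝ → ℝ) : ℝ := Real.sqrt (∫ x in (0:ℝ)..(2 * Real.pi), (v x) ^ 2)

/-- A smooth solution of the damped–driven KdV equation
`∂ₜu + u ∂ₓu + ∂ₓ³u + γu = f` on `[0,∞) × ℝ`, mean-zero `2π`-periodic in `x`. -/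
def IsDampedKdVSol (γ : ℝ) (f : ℝ → ℝ) (u : ℝ → ℝ → ℝ) : Prop :=
  ContDiff ℝ (⊤ : ℕ∞) (fun p : ℝ × ℝ => u p.1 p.2) ∧
  (∀ t : ℝ, 0 ≤ t → SmoothMeanZeroPeriodic (u t)) ∧
  (∀ t x : ℝ, 0 ≤ t →
    deriv (fun s => u s x) t + u t x * deriv (u t) x + iteratedDeriv 3 (u t) x
      + γ * u t x = f x)

section

open Set Topology

lemma L2norm_nonneg (f : ℝ → ℝ) : 0 ≤ L2norm f := Real.sqrt_nonneg _

lemma L2norm_sq (f : ℝ → ℝ) : L2norm f ^ 2 = ∫ x in (0:ℝ)..(2 * Real.pi), (f x) ^ 2 :=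
  Real.sq_sqrt (intervalIntegral.integral_nonneg Real.two_pi_pos.le fun _ _ => sq_nonneg _)

/-- The Cauchy–Schwarz inequality over one period. -/
lemma integral_abs_mul_le_L2norm_mul {f g : ℝ → ℝ} (hf : Continuous f) (hg : Continuous g) :
    ∫ x in (0:ℝ)..(2 * Real.pi), |f x * g x| ≤ L2norm f * L2norm g := by
  have key : ∀ y : ℝ, 0 ≤ L2norm f ^ 2 * (y * y) +
      (2 * ∫ x in (0:ℝ)..(2 * Real.pi), |f x * g x|) * y + L2norm g ^ 2 := by
    intro y
    have h0 : 0 ≤ ∫ x in (0:ℝ)..(2 * Real.pi), (|f x| * y + |g x|) ^ 2 :=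
      intervalIntegral.integral_nonneg Real.two_pi_pos.le fun _ _ => sq_nonneg _
    have h1 : ∀ x, (|f x| * y + |g x|) ^ 2
        = (f x) ^ 2 * (y * y) + |f x * g x| * (2 * y) + (g x) ^ 2 := by
      intro x
      rw [abs_mul, ← sq_abs (f x), ← sq_abs (g x)]
      ring
    simp_rw [h1] at h0
    rw [intervalIntegral.integral_add
        (Continuous.intervalIntegrable (by fun_prop) _ _)
        (Continuous.intervalIntegrable (by fun_prop) _ _),
      intervalIntegral.integral_add
        (Continuous.intervalIntegrable (by fun_prop) _ _)
        (Continuous.intervalIntegrable (by fun_prop) _ _),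
      intervalIntegral.integral_mul_const, intervalIntegral.integral_mul_const,
      ← L2norm_sq, ← L2norm_sq] at h0
    linarith
  have hd := discrim_le_zero key
  rw [discrim] at hd
  have hp := mul_nonneg (L2norm_nonneg f) (L2norm_nonneg g)
  refine le_of_pow_le_pow_left₀ two_ne_zero hp ?_
  nlinarith [hd]

lemma periodic_deriv {f : ℝ → ℝ} {c : ℝ} (hf : Function.Periodic f c) :
    Function.Periodic (deriv f) c := by
  intro x
  rw [← deriv_comp_add_const, funext hf]

/-- The derivative of a periodic function integrates to zero over a period. -/
lemma integral_eq_zero_of_hasDerivAt_periodic {F F' : ℝ → ℝ}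
    (hF : ∀ x, HasDerivAt F (F' x) x) (hF' : Continuous F')
    (hper : Function.Periodic F (2 * Real.pi)) :
    ∫ x in (0:ℝ)..(2 * Real.pi), F' x = 0 := by
  rw [intervalIntegral.integral_eq_sub_of_hasDerivAt (fun x _ => hF x)
    (hF'.intervalIntegrable _ _)]
  have := hper 0
  rw [zero_add] at this
  rw [this, sub_self]

/-- Monotonicity of the integral over a period, up to a term of zero integral. -/
lemma integral_le_of_add_le {f g h : ℝ → ℝ} (hf : Continuous f) (hg : Continuous g)
    (hh : Continuous h) (hz : ∫ x in (0:ℝ)..(2 * Real.pi), h x = 0)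
    (hle : ∀ x ∈ Icc 0 (2 * Real.pi), f x + h x ≤ g x) :
    ∫ x in (0:ℝ)..(2 * Real.pi), f x ≤ ∫ x in (0:ℝ)..(2 * Real.pi), g x := by
  have hm := intervalIntegral.integral_mono_on (μ := volume) Real.two_pi_pos.le
    ((hf.add hh).intervalIntegrable _ _) (hg.intervalIntegrable _ _) hle
  simp only [Pi.add_apply] at hm
  rwa [intervalIntegral.integral_add (hf.intervalIntegrable _ _) (hh.intervalIntegrable _ _), hz,
    add_zero] at hm

lemma hasDerivAt_of_smooth {f : ℝ → ℝ} (hf : ContDiff ℝ (⊤ : ℕ∞) f) (x : ℝ) :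
    HasDerivAt f (deriv f x) x :=
  ((contDiff_infty_iff_deriv.mp hf).1 x).hasDerivAt

/-- `‖∂ₓa‖² ≤ ‖a‖ ‖∂ₓ²a‖` for periodic functions. -/
lemma L2norm_deriv_sq_le {a : ℝ → ℝ} (ha : ContDiff ℝ (⊤ : ℕ∞) a)
    (hper : Function.Periodic a (2 * Real.pi)) :
    L2norm (deriv a) ^ 2 ≤ L2norm a * L2norm (deriv (deriv a)) := by
  have ha1 := (contDiff_infty_iff_deriv.mp ha).2
  have ha2 := (contDiff_infty_iff_deriv.mp ha1).2
  have c0 := ha.continuous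
  have c1 := ha1.continuous
  have c2 := ha2.continuous
  have hz := integral_eq_zero_of_hasDerivAt_periodic
    (fun x => (hasDerivAt_of_smooth ha x).mul (hasDerivAt_of_smooth ha1 x))
    (by fun_prop) (hper.mul (periodic_deriv hper))
  refine le_trans ?_ (integral_abs_mul_le_L2norm_mul c0 c2)
  rw [L2norm_sq]
  refine integral_le_of_add_le
    (h := fun x => -(deriv a x * deriv a x + a x * deriv (deriv a) x))
    (by fun_prop) (by fun_prop) (by fun_prop)
    (by rw [intervalIntegral.integral_neg, hz, neg_zero]) fun x _ => ?_
  linarith [neg_abs_le (a x * deriv (deriv a) x)]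

/-- Agmon's inequality for the derivative of a periodic function. -/
lemma deriv_sq_le {a : ℝ → ℝ} (ha : ContDiff ℝ (⊤ : ℕ∞) a)
    (hper : Function.Periodic a (2 * Real.pi)) {x : ℝ} (hx : x ∈ Icc 0 (2 * Real.pi)) :
    (deriv a x) ^ 2 ≤ 2 * (L2norm (deriv a) * L2norm (deriv (deriv a))) := by
  have ha1 := (contDiff_infty_iff_deriv.mp ha).2
  have ha2 := (contDiff_infty_iff_deriv.mp ha1).2
  have c1 := ha1.continuous
  have c2 := ha2.continuous
  obtain ⟨z, hz, hz0⟩ := exists_deriv_eq_zero Real.two_pi_pos ha.continuous.continuousOn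
    (by simpa using (hper 0).symm)
  have hftc : ∫ y in z..x, 2 * (deriv a y * deriv (deriv a) y) = deriv a x ^ 2 := by
    rw [intervalIntegral.integral_eq_sub_of_hasDerivAt (f := fun y => deriv a y ^ 2)]
    · simp [hz0]
    · intro y _
      refine ((hasDerivAt_of_smooth ha1 y).fun_pow 2).congr_deriv ?_
      push_cast
      ring
    · exact Continuous.intervalIntegrable (by fun_prop) _ _
  have hsub : uIoc z x ⊆ uIoc 0 (2 * Real.pi) :=
    Ioc_subset_Ioc (inf_le_left.trans (le_inf hz.1.le hx.1))
      ((sup_le hz.2.le hx.2).trans le_sup_right)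
  have hint : Continuous fun y => |deriv a y * deriv (deriv a) y| := by fun_prop
  calc (deriv a x) ^ 2 = 2 * ∫ y in z..x, deriv a y * deriv (deriv a) y := by
        rw [← hftc, intervalIntegral.integral_const_mul]
    _ ≤ 2 * ∫ y in (0:ℝ)..(2 * Real.pi), |deriv a y * deriv (deriv a) y| := by
        gcongr
        refine (Real.le_norm_self _).trans
          (intervalIntegral.norm_integral_le_integral_norm_uIoc.trans ?_)
        rw [intervalIntegral.integral_of_le Real.two_pi_pos.le, ← uIoc_of_le Real.two_pi_pos.le]
        refine setIntegral_mono_set ?_ (Eventually.of_forall fun _ => abs_nonneg _)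
          hsub.eventuallyLE
        exact intervalIntegrable_iff.mp (hint.intervalIntegrable _ _)
    _ ≤ _ := by
        gcongr
        exact integral_abs_mul_le_L2norm_mul c1 c2

/-- The interpolation inequality `‖∂ₓa‖_∞ ≤ 4 ‖∂ₓ²a‖^{3/4} ‖a‖^{1/4}`. -/
lemma abs_deriv_le {a : ℝ → ℝ} (ha : ContDiff ℝ (⊤ : ℕ∞) a)
    (hper : Function.Periodic a (2 * Real.pi)) {x : ℝ} (hx : x ∈ Icc 0 (2 * Real.pi)) :
    |deriv a x| ≤ 4 * (L2norm (iteratedDeriv 2 a) ^ ((3:ℝ)/4) * L2norm a ^ ((1:ℝ)/4)) := by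
  have h2 : iteratedDeriv 2 a = deriv (deriv a) := by
    rw [iteratedDeriv_succ, iteratedDeriv_one]
  rw [h2]
  have i1 := L2norm_deriv_sq_le ha hper
  have i2 := deriv_sq_le ha hper hx
  have n0 := L2norm_nonneg a
  have n1 := L2norm_nonneg (deriv a)
  have n2 := L2norm_nonneg (deriv (deriv a))
  set A := L2norm a
  set B := L2norm (deriv a)
  set C := L2norm (deriv (deriv a))
  refine le_of_pow_le_pow_left₀ (n := 8) (by norm_num) (by positivity) ?_
  have e1 : (C ^ ((3:ℝ)/4)) ^ 8 = C ^ 6 := by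
    rw [← Real.rpow_natCast, ← Real.rpow_mul n2, ← Real.rpow_natCast]
    norm_num
  have e2 : (A ^ ((1:ℝ)/4)) ^ 8 = A ^ 2 := by
    rw [← Real.rpow_natCast, ← Real.rpow_mul n0, ← Real.rpow_natCast]
    norm_num
  calc |deriv a x| ^ 8 = ((deriv a x) ^ 2) ^ 4 := by rw [← sq_abs]; ring
    _ ≤ (2 * (B * C)) ^ 4 := by gcongr
    _ = 16 * (B ^ 2) ^ 2 * C ^ 4 := by ring
    _ ≤ 16 * (A * C) ^ 2 * C ^ 4 := by gcongr
    _ ≤ 4 ^ 8 * (C ^ 6 * A ^ 2) := by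
        have : 0 ≤ C ^ 6 * A ^ 2 := by positivity
        nlinarith
    _ = _ := by rw [mul_pow, mul_pow, e1, e2]

/-- Partial derivatives in the second variable of a jointly smooth function are jointly smooth. -/
lemma contDiff_uncurry_deriv {F : ℝ → ℝ → ℝ}
    (hF : ContDiff ℝ (⊤ : ℕ∞) fun p : ℝ × ℝ => F p.1 p.2) :
    ContDiff ℝ (⊤ : ℕ∞) fun p : ℝ × ℝ => deriv (F p.1) p.2 := by
  have h : ∀ p : ℝ × ℝ, deriv (F p.1) p.2
      = fderiv ℝ (fun p : ℝ × ℝ => F p.1 p.2) p (0, 1) := by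
    intro p
    have hd := (hF.differentiable (by simp) p).hasFDerivAt
    exact (hd.comp_hasDerivAt p.2 ((hasDerivAt_const p.2 p.1).prodMk (hasDerivAt_id p.2))).deriv
  simp_rw [h]
  exact (hF.fderiv_right (m := (⊤ : ℕ∞)) (by simp)).clm_apply contDiff_const

lemma continuous_L2norm {F : ℝ → ℝ → ℝ} (hF : Continuous fun p : ℝ × ℝ => F p.1 p.2) :
    Continuous fun s => L2norm (F s) :=
  Real.continuous_sqrt.comp <|
    intervalIntegral.continuous_parametric_intervalIntegral_of_continuous' (hF.pow 2) _ _

/-- Differentiation of `‖F(t,·)‖²` under the integral sign. -/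
lemma hasDerivAt_L2norm_sq {F : ℝ → ℝ → ℝ}
    (hF : ContDiff ℝ (⊤ : ℕ∞) fun p : ℝ × ℝ => F p.1 p.2) (t : ℝ) :
    HasDerivAt (fun s => L2norm (F s) ^ 2)
      (∫ x in (0:ℝ)..(2 * Real.pi), 2 * F t x * deriv (fun s => F s x) t) t := by
  simp_rw [L2norm_sq]
  have hswap : ContDiff ℝ (⊤ : ℕ∞) fun p : ℝ × ℝ => F p.2 p.1 :=
    hF.comp (contDiff_snd.prodMk contDiff_fst)
  have hc : Continuous fun p : ℝ × ℝ => F p.1 p.2 := hF.continuous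
  have hct : Continuous fun p : ℝ × ℝ => deriv (fun s => F s p.2) p.1 :=
    (contDiff_uncurry_deriv (F := fun x s => F s x) hswap).continuous.comp
      (continuous_snd.prodMk continuous_fst)
  have hcF' : Continuous fun p : ℝ × ℝ => 2 * F p.1 p.2 * deriv (fun s => F s p.2) p.1 := by
    fun_prop
  obtain ⟨M, hM⟩ := ((isCompact_Icc (a := t - 1) (b := t + 1)).prod
    (isCompact_uIcc (a := (0:ℝ)) (b := 2 * Real.pi))).exists_bound_of_continuousOn
      hcF'.continuousOn
  refine (intervalIntegral.hasDerivAt_integral_of_dominated_loc_of_deriv_le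
    (F' := fun s x => 2 * F s x * deriv (fun s => F s x) s)
    (bound := fun _ => M) (s := Icc (t - 1) (t + 1))
    (Icc_mem_nhds (by linarith) (by linarith)) ?_ ?_ ?_ ?_ ?_ ?_).2
  · exact Eventually.of_forall fun s =>
      ((hc.comp (Continuous.prodMk_right s)).pow 2).aestronglyMeasurable
  · exact ((hc.comp (Continuous.prodMk_right t)).pow 2).intervalIntegrable _ _
  · exact (hcF'.comp (Continuous.prodMk_right t)).aestronglyMeasurable
  · exact Eventually.of_forall fun x hx s hs => hM (s, x) ⟨hs, uIoc_subset_uIcc hx⟩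
  · exact intervalIntegrable_const
  · refine Eventually.of_forall fun x _ s _ => ?_
    have hd : HasDerivAt (fun s => F s x) (deriv (fun s => F s x) s) s :=
      hasDerivAt_of_smooth (hF.comp (contDiff_id.prodMk contDiff_const)) s
    refine (hd.fun_pow 2).congr_deriv ?_
    push_cast
    ring

/-- The energy inequality for the difference of two spatial profiles, with `|∂ₓ(p + q)| ≤ 4G`. -/
lemma energy_inequality {p q : ℝ → ℝ} {γ G : ℝ}
    (hp : ContDiff ℝ (⊤ : ℕ∞) p) (hq : ContDiff ℝ (⊤ : ℕ∞) q)
    (pp : Function.Periodic p (2 * Real.pi)) (pq : Function.Periodic q (2 * Real.pi))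
    (hG : ∀ x ∈ Icc 0 (2 * Real.pi), |deriv p x + deriv q x| ≤ 4 * G) :
    ∫ x in (0:ℝ)..(2 * Real.pi), 2 * (p x - q x) *
        (-(p x * deriv p x - q x * deriv q x)
          - (deriv (deriv (deriv p)) x - deriv (deriv (deriv q)) x) - γ * (p x - q x))
      ≤ (-2 * γ + 2 * G) * L2norm (fun x => p x - q x) ^ 2 := by
  have hp1 := (contDiff_infty_iff_deriv.mp hp).2
  have hp2 := (contDiff_infty_iff_deriv.mp hp1).2
  have hp3 := (contDiff_infty_iff_deriv.mp hp2).2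
  have hq1 := (contDiff_infty_iff_deriv.mp hq).2
  have hq2 := (contDiff_infty_iff_deriv.mp hq1).2
  have hq3 := (contDiff_infty_iff_deriv.mp hq2).2
  have cp := hp.continuous
  have cp1 := hp1.continuous
  have cp2 := hp2.continuous
  have cp3 := hp3.continuous
  have cq := hq.continuous
  have cq1 := hq1.continuous
  have cq2 := hq2.continuous
  have cq3 := hq3.continuous
  have pp1 := periodic_deriv pp
  have pp2 := periodic_deriv pp1
  have pq1 := periodic_deriv pq
  have pq2 := periodic_deriv pq1
  have hflux := integral_eq_zero_of_hasDerivAt_periodic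
    (F := fun x => 1 / 2 * (p x + q x) * (p x - q x) ^ 2
      + 2 * (p x - q x) * (deriv (deriv p) x - deriv (deriv q) x) - (deriv p x - deriv q x) ^ 2)
    (F' := fun x => 1 / 2 * (deriv p x + deriv q x) * (p x - q x) ^ 2
      + (p x + q x) * (p x - q x) * (deriv p x - deriv q x)
      + 2 * (p x - q x) * (deriv (deriv (deriv p)) x - deriv (deriv (deriv q)) x))
    (fun x => by
      have d0 := hasDerivAt_of_smooth hp x
      have d1 := hasDerivAt_of_smooth hp1 x
      have d2 := hasDerivAt_of_smooth hp2 x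
      have b0 := hasDerivAt_of_smooth hq x
      have b1 := hasDerivAt_of_smooth hq1 x
      have b2 := hasDerivAt_of_smooth hq2 x
      refine HasDerivAt.congr_deriv (((((d0.add b0).const_mul (1 / 2)).mul ((d0.sub b0).pow 2)).add
        (((d0.sub b0).const_mul 2).mul (d2.sub b2))).sub ((d1.sub b1).pow 2)) ?_
      simp only [Pi.add_apply, Pi.sub_apply, Pi.pow_apply]
      push_cast
      ring)
    (by fun_prop)
    (fun x => by
      beta_reduce
      rw [pp, pq, pp1, pq1, pp2, pq2])
  rw [L2norm_sq, ← intervalIntegral.integral_const_mul]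
  refine integral_le_of_add_le (by fun_prop) (by fun_prop) (by fun_prop) hflux fun x hx => ?_
  have h1 := neg_le_of_abs_le (hG x hx)
  have h2 := mul_nonneg (by linarith : 0 ≤ 4 * G + (deriv p x + deriv q x))
    (sq_nonneg (p x - q x))
  linarith

/-- Grönwall inequality for `dE/dt ≤ (-2γ + 2g) E`. -/
lemma le_mul_exp_of_deriv_le {E E' g : ℝ → ℝ} {γ : ℝ} (hg : Continuous g)
    (hE : ∀ t, HasDerivAt E (E' t) t) (hle : ∀ t, 0 ≤ t → E' t ≤ (-2 * γ + 2 * g t) * E t)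
    {t : ℝ} (ht : 0 ≤ t) :
    E t ≤ E 0 * Real.exp (2 * (-γ * t + ∫ s in (0:ℝ)..t, g s)) := by
  have hK : ∀ t, HasDerivAt (fun t => -(2 * (-γ * t + ∫ s in (0:ℝ)..t, g s)))
      (-(2 * (-γ + g t))) t := by
    intro t
    have h1 : HasDerivAt (fun t => ∫ s in (0:ℝ)..t, g s) (g t) t :=
      intervalIntegral.integral_hasDerivAt_right (hg.intervalIntegrable _ _)
        (hg.stronglyMeasurableAtFilter _ _) hg.continuousAt
    have h2 := (hasDerivAt_id t).const_mul (-γ)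
    rw [mul_one] at h2
    exact ((h2.add h1).const_mul 2).neg
  have hH := fun t => (hE t).mul (hK t).exp
  have hanti : AntitoneOn
      (E * fun t => Real.exp (-(2 * (-γ * t + ∫ s in (0:ℝ)..t, g s)))) (Ici 0) := by
    refine antitoneOn_of_deriv_nonpos (convex_Ici 0)
      (fun s _ => (hH s).continuousAt.continuousWithinAt)
      (fun s _ => (hH s).differentiableAt.differentiableWithinAt) fun s hs => ?_
    rw [interior_Ici] at hs
    rw [(hH s).deriv]
    have := mul_nonneg (sub_nonneg.mpr (hle s (le_of_lt hs)))
      (Real.exp_pos (-(2 * (-γ * s + ∫ r in (0:ℝ)..s, g r)))).le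
    linarith
  have h := hanti (self_mem_Ici) ht ht
  simp only [Pi.mul_apply, intervalIntegral.integral_same, mul_zero, add_zero, neg_zero,
    Real.exp_zero, mul_one] at h
  rw [Real.exp_neg, ← div_eq_mul_inv, div_le_iff₀ (Real.exp_pos _)] at h
  exact h

end

/-- `L²` stability estimate for two solutions of damped–driven KdV. -/
theorem L2_stability_estimate :
    ∃ c : ℝ, 0 < c ∧
      ∀ γ : ℝ, 0 < γ → ∀ f : ℝ → ℝ, SmoothMeanZeroPeriodic f →
        ∀ u v : ℝ → ℝ → ℝ, IsDampedKdVSol γ f u → IsDampedKdVSol γ f v →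
          ∀ t : ℝ, 0 ≤ t →
            L2norm (fun x => u t x - v t x)
              ≤ L2norm (fun x => u 0 x - v 0 x) *
                Real.exp (-γ * t + c * ∫ s in (0:ℝ)..t,
                  (L2norm (iteratedDeriv 2 (fun x => u s x + v s x))) ^ ((3:ℝ)/4) *
                    (L2norm (fun x => u s x + v s x)) ^ ((1:ℝ)/4)) := by
  refine ⟨1, one_pos, fun γ _ f _ u v ⟨hu, hup, hue⟩ ⟨hv, hvp, hve⟩ t ht => ?_⟩
  have hw : ContDiff ℝ (⊤ : ℕ∞) fun p : ℝ × ℝ => u p.1 p.2 - v p.1 p.2 := hu.sub hv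
  have ha : ContDiff ℝ (⊤ : ℕ∞) fun p : ℝ × ℝ => u p.1 p.2 + v p.1 p.2 := hu.add hv
  have hg : Continuous fun s => L2norm (iteratedDeriv 2 (fun x => u s x + v s x)) ^ ((3:ℝ)/4) *
      L2norm (fun x => u s x + v s x) ^ ((1:ℝ)/4) := by
    have h2 : Continuous fun s => L2norm (iteratedDeriv 2 (fun x => u s x + v s x)) := by
      simp_rw [iteratedDeriv_succ, iteratedDeriv_zero]
      exact continuous_L2norm (contDiff_uncurry_deriv
        (F := fun s => deriv fun x => u s x + v s x)
        (contDiff_uncurry_deriv (F := fun s x => u s x + v s x) ha)).continuous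
    have h0 : Continuous fun s => L2norm (fun x => u s x + v s x) :=
      continuous_L2norm (F := fun s x => u s x + v s x) ha.continuous
    exact (h2.rpow_const fun _ => Or.inr (by norm_num)).mul
      (h0.rpow_const fun _ => Or.inr (by norm_num))
  have key := le_mul_exp_of_deriv_le (γ := γ) hg
    (hasDerivAt_L2norm_sq (F := fun s x => u s x - v s x) hw) (fun s hs => ?_) ht
  · rw [one_mul]
    refine le_of_pow_le_pow_left₀ two_ne_zero
      (mul_nonneg (L2norm_nonneg _) (Real.exp_pos _).le) ?_
    rw [mul_pow, ← Real.exp_nat_mul]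
    exact_mod_cast key
  · have smooth_slice : ∀ {w : ℝ → ℝ → ℝ},
        ContDiff ℝ (⊤ : ℕ∞) (fun p : ℝ × ℝ => w p.1 p.2) → ∀ x,
          DifferentiableAt ℝ (fun s => w s x) s := fun hw x =>
      (hasDerivAt_of_smooth (hw.comp (contDiff_id.prodMk contDiff_const)) s).differentiableAt
    obtain ⟨su, pu, -⟩ := hup s hs
    obtain ⟨sv, pv, -⟩ := hvp s hs
    refine le_trans (le_of_eq ?_) (energy_inequality su sv pu pv fun x hx => ?_)
    · refine intervalIntegral.integral_congr fun x _ => ?_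
      have e1 := hue s x hs
      have e2 := hve s x hs
      simp only [iteratedDeriv_succ, iteratedDeriv_zero] at e1 e2
      rw [deriv_fun_sub (smooth_slice hu x) (smooth_slice hv x)]
      congr 1
      linarith
    · have := abs_deriv_le (su.add sv) (Function.Periodic.add pu pv) hx
      rwa [deriv_fun_add (hasDerivAt_of_smooth su x).differentiableAt
        (hasDerivAt_of_smooth sv x).differentiableAt] at this
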